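/- Let 0 < η₁ < η₂ and define W(m) = (m²+1)/2 + m²(m²−1)/(m²−1+eE(m)/eK(m)) for m ∈ (0,1), where eK(m) = ∫₀^{π/2} (1 − m² sin² y)^{−1/2} dy and eE(m) = ∫₀^{π/2} (1 − m² sin² y)^{1/2} dy. Then the map α ↦ η₂² W(α/η₂) is a continuous, strictly increasing bijection from the interval (η₁, η₂) onto the interval (ξ_crit, η₂²), where ξ_crit = η₂² W(η₁/η₂). In particular, for every ξ ∈ (ξ_crit, η₂²) there exists a unique α ∈ (η₁, η₂) satisfying the Whitham evolution equation ξ = η₂² W(α/η₂). -/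

import Mathlib

open Real Set

/-- The complete elliptic integral of the first kind,
`eK(m) = ∫₀^{π/2} (1 - m² sin² y)^{-1/2} dy`. -/
noncomputable def eK (m : ℝ) : ℝ :=
  ∫ y in (0 : ℝ)..(π / 2), 1 / Real.sqrt (1 - m ^ 2 * Real.sin y ^ 2)

/-- The complete elliptic integral of the second kind,
`eE(m) = ∫₀^{π/2} (1 - m² sin² y)^{1/2} dy`. -/
noncomputable def eE (m : ℝ) : ℝ :=
  ∫ y in (0 : ℝ)..(π / 2), Real.sqrt (1 - m ^ 2 * Real.sin y ^ 2)

/-- The function `W(m) = (m²+1)/2 + m²(m²-1)/(m²-1+eE(m)/eK(m))`. -/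
noncomputable def W (m : ℝ) : ℝ :=
  (m ^ 2 + 1) / 2 + m ^ 2 * (m ^ 2 - 1) / (m ^ 2 - 1 + eE m / eK m)

lemma one_sub_sq_le_one_sub_sq_mul_sin_sq (m y : ℝ) :
    1 - m ^ 2 ≤ 1 - m ^ 2 * Real.sin y ^ 2 := by
  nlinarith [Real.sin_sq_le_one y, sq_nonneg m]

lemma one_sub_sq_pos {m : ℝ} (hm : m ∈ Ioo (0 : ℝ) 1) : 0 < 1 - m ^ 2 := by
  nlinarith [hm.1, hm.2]

lemma one_sub_sq_mul_sin_sq_pos {m : ℝ} (hm : m ∈ Ioo (0 : ℝ) 1) (y : ℝ) :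
    0 < 1 - m ^ 2 * Real.sin y ^ 2 :=
  (one_sub_sq_pos hm).trans_le (one_sub_sq_le_one_sub_sq_mul_sin_sq m y)

/-- The complete elliptic integral `∫₀^{π/2} cos² y (1 - m² sin² y)^{-1/2} dy`. -/
noncomputable def eB (m : ℝ) : ℝ :=
  ∫ y in (0 : ℝ)..(π / 2), Real.cos y ^ 2 / Real.sqrt (1 - m ^ 2 * Real.sin y ^ 2)

lemma continuous_div_sqrt_one_sub {m : ℝ} (hm : m ∈ Ioo (0 : ℝ) 1) {f : ℝ → ℝ}
    (hf : Continuous f) :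
    Continuous fun y => f y / Real.sqrt (1 - m ^ 2 * Real.sin y ^ 2) :=
  hf.div (by fun_prop) fun y => (Real.sqrt_pos.2 (one_sub_sq_mul_sin_sq_pos hm y)).ne'

lemma intervalIntegrable_div_sqrt_one_sub {m : ℝ} (hm : m ∈ Ioo (0 : ℝ) 1) {f : ℝ → ℝ}
    (hf : Continuous f) (a b : ℝ) :
    IntervalIntegrable (fun y => f y / Real.sqrt (1 - m ^ 2 * Real.sin y ^ 2))
      MeasureTheory.volume a b :=
  (continuous_div_sqrt_one_sub hm hf).intervalIntegrable a b

lemma pi_div_four_le_eB {m : ℝ} (hm : m ∈ Ioo (0 : ℝ) 1) : π / 4 ≤ eB m := by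
  have h : ∫ y in (0 : ℝ)..(π / 2), Real.cos y ^ 2 = π / 4 := by
    rw [integral_cos_sq]; simp; ring
  rw [← h]
  refine intervalIntegral.integral_mono_on (by positivity)
    (Continuous.intervalIntegrable (by fun_prop) _ _)
    (intervalIntegrable_div_sqrt_one_sub hm (by fun_prop) _ _) fun y _ => ?_
  refine le_div_self (sq_nonneg _) (Real.sqrt_pos.2 (one_sub_sq_mul_sin_sq_pos hm y)) ?_
  exact Real.sqrt_le_one.2 (by nlinarith [mul_nonneg (sq_nonneg m) (sq_nonneg (Real.sin y))])

lemma eB_pos {m : ℝ} (hm : m ∈ Ioo (0 : ℝ) 1) : 0 < eB m :=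
  lt_of_lt_of_le (by positivity) (pi_div_four_le_eB hm)

lemma eB_mono : MonotoneOn eB (Ioo 0 1) := by
  intro a ha b hb hab
  refine intervalIntegral.integral_mono_on (by positivity)
    (intervalIntegrable_div_sqrt_one_sub ha (by fun_prop) _ _)
    (intervalIntegrable_div_sqrt_one_sub hb (by fun_prop) _ _) fun y _ => ?_
  have := Real.sqrt_pos.2 (one_sub_sq_mul_sin_sq_pos hb y)
  have := ha.1
  gcongr

lemma eK_pos {m : ℝ} (hm : m ∈ Ioo (0 : ℝ) 1) : 0 < eK m :=
  intervalIntegral.intervalIntegral_pos_of_pos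
    (intervalIntegrable_div_sqrt_one_sub hm continuous_const _ _)
    (fun y => div_pos one_pos (Real.sqrt_pos.2 (one_sub_sq_mul_sin_sq_pos hm y))) (by positivity)

lemma one_sub_sq_mul_eK_antitone : AntitoneOn (fun m => (1 - m ^ 2) * eK m) (Ioo 0 1) := by
  intro a ha b hb hab
  simp only [eK, ← intervalIntegral.integral_const_mul]
  refine intervalIntegral.integral_mono_on (by positivity)
    ((intervalIntegrable_div_sqrt_one_sub hb continuous_const _ _).const_mul _)
    ((intervalIntegrable_div_sqrt_one_sub ha continuous_const _ _).const_mul _) fun y _ => ?_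
  have hpa := one_sub_sq_mul_sin_sq_pos ha y
  have hpb := one_sub_sq_mul_sin_sq_pos hb y
  have ha1 := one_sub_sq_pos ha
  have hb1 := one_sub_sq_pos hb
  have hsq : a ^ 2 ≤ b ^ 2 := pow_le_pow_left₀ ha.1.le hab 2
  have hs := Real.sin_sq_le_one y
  rw [mul_one_div, mul_one_div, div_le_div_iff₀ (Real.sqrt_pos.2 hpb) (Real.sqrt_pos.2 hpa)]
  refine le_of_sq_le_sq ?_ (by positivity)
  rw [mul_pow, mul_pow, Real.sq_sqrt hpa.le, Real.sq_sqrt hpb.le]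
  have hcross : (1 - b ^ 2) * (1 - a ^ 2 * Real.sin y ^ 2)
      ≤ (1 - a ^ 2) * (1 - b ^ 2 * Real.sin y ^ 2) := by
    nlinarith [mul_nonneg (sub_nonneg.2 hsq) (sub_nonneg.2 hs)]
  calc (1 - b ^ 2) ^ 2 * (1 - a ^ 2 * Real.sin y ^ 2)
      = (1 - b ^ 2) * ((1 - b ^ 2) * (1 - a ^ 2 * Real.sin y ^ 2)) := by ring
    _ ≤ (1 - a ^ 2) * ((1 - a ^ 2) * (1 - b ^ 2 * Real.sin y ^ 2)) :=
        mul_le_mul (by linarith) hcross (by positivity) ha1.le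
    _ = (1 - a ^ 2) ^ 2 * (1 - b ^ 2 * Real.sin y ^ 2) := by ring

lemma one_sub_sq_mul_eK_le {m : ℝ} (hm : m ∈ Ioo (0 : ℝ) 1) :
    (1 - m ^ 2) * eK m ≤ Real.sqrt (1 - m ^ 2) * (π / 2) := by
  have hp := one_sub_sq_pos hm
  have hK : eK m ≤ ∫ _ in (0 : ℝ)..(π / 2), 1 / Real.sqrt (1 - m ^ 2) := by
    refine intervalIntegral.integral_mono_on (by positivity)
      (intervalIntegrable_div_sqrt_one_sub hm continuous_const _ _)
      (continuous_const.intervalIntegrable _ _) fun y _ => ?_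
    exact one_div_le_one_div_of_le (Real.sqrt_pos.2 hp)
      (Real.sqrt_le_sqrt (one_sub_sq_le_one_sub_sq_mul_sin_sq m y))
  rw [intervalIntegral.integral_const, smul_eq_mul, sub_zero] at hK
  calc (1 - m ^ 2) * eK m ≤ (1 - m ^ 2) * (π / 2 * (1 / Real.sqrt (1 - m ^ 2))) := by gcongr
    _ = (1 - m ^ 2) / Real.sqrt (1 - m ^ 2) * (π / 2) := by ring
    _ = Real.sqrt (1 - m ^ 2) * (π / 2) := by rw [Real.div_sqrt]

lemma eE_sub_eq_sq_mul_eB {m : ℝ} (hm : m ∈ Ioo (0 : ℝ) 1) :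
    eE m - (1 - m ^ 2) * eK m = m ^ 2 * eB m := by
  simp only [eE, eK, eB, ← intervalIntegral.integral_const_mul]
  rw [← intervalIntegral.integral_sub (Continuous.intervalIntegrable (by fun_prop) _ _)
    ((intervalIntegrable_div_sqrt_one_sub hm continuous_const _ _).const_mul _)]
  refine intervalIntegral.integral_congr fun y _ => ?_
  have hp := one_sub_sq_mul_sin_sq_pos hm y
  have hs := Real.sqrt_pos.2 hp
  have hsq := Real.sq_sqrt hp.le
  field_simp
  rw [hsq, Real.cos_sq']
  ring

lemma sq_sub_one_add_eE_div_eK {m : ℝ} (hm : m ∈ Ioo (0 : ℝ) 1) :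
    m ^ 2 - 1 + eE m / eK m = m ^ 2 * eB m / eK m := by
  have hK := eK_pos hm
  rw [← eE_sub_eq_sq_mul_eB hm]
  field_simp
  ring

lemma W_eq {m : ℝ} (hm : m ∈ Ioo (0 : ℝ) 1) :
    W m = (m ^ 2 + 1) / 2 - (1 - m ^ 2) * eK m / eB m := by
  have hK := eK_pos hm
  have hB := eB_pos hm
  have := hm.1
  rw [W, sq_sub_one_add_eE_div_eK hm]
  field_simp
  ring

lemma W_strictMonoOn : StrictMonoOn W (Ioo 0 1) := by
  intro a ha b hb hab
  have hsq : a ^ 2 < b ^ 2 := pow_lt_pow_left₀ hab ha.1.le two_ne_zero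
  have h : (1 - b ^ 2) * eK b / eB b ≤ (1 - a ^ 2) * eK a / eB a :=
    div_le_div₀ (mul_pos (one_sub_sq_pos ha) (eK_pos ha)).le
      (one_sub_sq_mul_eK_antitone ha hb hab.le) (eB_pos ha) (eB_mono ha hb hab.le)
  rw [W_eq ha, W_eq hb]
  linarith

lemma W_lt_one {m : ℝ} (hm : m ∈ Ioo (0 : ℝ) 1) : W m < 1 := by
  have h := div_pos (mul_pos (one_sub_sq_pos hm) (eK_pos hm)) (eB_pos hm)
  rw [W_eq hm]
  linarith [one_sub_sq_pos hm]

lemma le_W {m : ℝ} (hm : m ∈ Ioo (0 : ℝ) 1) :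
    (m ^ 2 + 1) / 2 - 2 * Real.sqrt (1 - m ^ 2) ≤ W m := by
  have h : (1 - m ^ 2) * eK m / eB m ≤ Real.sqrt (1 - m ^ 2) * (π / 2) / (π / 4) :=
    div_le_div₀ (by positivity) (one_sub_sq_mul_eK_le hm) (by positivity) (pi_div_four_le_eB hm)
  have h2 : Real.sqrt (1 - m ^ 2) * (π / 2) / (π / 4) = 2 * Real.sqrt (1 - m ^ 2) := by
    field_simp; norm_num
  rw [W_eq hm]
  linarith

lemma tendsto_W_one : Filter.Tendsto W (nhdsWithin 1 (Iio 1)) (nhds 1) := by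
  have hmem : ∀ᶠ m in nhdsWithin (1 : ℝ) (Iio 1), m ∈ Ioo (0 : ℝ) 1 :=
    Ioo_mem_nhdsLT one_pos
  have hlow : Filter.Tendsto (fun m : ℝ => (m ^ 2 + 1) / 2 - 2 * Real.sqrt (1 - m ^ 2))
      (nhdsWithin 1 (Iio 1)) (nhds 1) := by
    have hc : Continuous fun m : ℝ => (m ^ 2 + 1) / 2 - 2 * Real.sqrt (1 - m ^ 2) := by fun_prop
    have h := hc.tendsto 1
    norm_num at h
    exact h.mono_left nhdsWithin_le_nhds
  exact tendsto_of_tendsto_of_tendsto_of_le_of_le' hlow tendsto_const_nhds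
    (hmem.mono fun _ => le_W) (hmem.mono fun _ hm => (W_lt_one hm).le)

lemma eE_continuous : Continuous eE :=
  intervalIntegral.continuous_parametric_intervalIntegral_of_continuous' (by fun_prop) _ _

lemma eK_continuousAt {m : ℝ} (hm : m ∈ Ioo (0 : ℝ) 1) : ContinuousAt eK m := by
  obtain ⟨c, hmc, hc⟩ := exists_between hm.2
  have hc0 : c ∈ Ioo (0 : ℝ) 1 := ⟨hm.1.trans hmc, hc⟩
  have hcont : Continuous fun x => ∫ y in (0 : ℝ)..(π / 2),
      1 / Real.sqrt (max (1 - c ^ 2) (1 - x ^ 2 * Real.sin y ^ 2)) := by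
    refine intervalIntegral.continuous_parametric_intervalIntegral_of_continuous' ?_ _ _
    refine continuous_const.div (by fun_prop) fun p => (Real.sqrt_pos.2 ?_).ne'
    exact lt_max_of_lt_left (one_sub_sq_pos hc0)
  refine hcont.continuousAt.congr ?_
  filter_upwards [Ioo_mem_nhds hm.1 hmc] with x hx
  refine intervalIntegral.integral_congr fun y _ => ?_
  have hxc : x ^ 2 ≤ c ^ 2 := pow_le_pow_left₀ hx.1.le hx.2.le 2
  have hle := one_sub_sq_le_one_sub_sq_mul_sin_sq x y
  rw [max_eq_right (by linarith)]

lemma W_continuousOn : ContinuousOn W (Ioo 0 1) := by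
  intro m hm
  have hK := eK_pos hm
  have hB := eB_pos hm
  have hm0 := hm.1
  have hden : m ^ 2 - 1 + eE m / eK m ≠ 0 := by
    rw [sq_sub_one_add_eE_div_eK hm]
    positivity
  have hKc := eK_continuousAt hm
  have hEc := eE_continuous.continuousAt (x := m)
  refine ContinuousAt.continuousWithinAt ?_
  unfold W
  exact ContinuousAt.add (by fun_prop)
    (ContinuousAt.div (by fun_prop) (ContinuousAt.add (by fun_prop) (hEc.div hKc hK.ne')) hden)

/-- `W` maps `(m₁, 1)` onto `(W(m₁), 1)`. -/
lemma W_surjOn {m₁ : ℝ} (hm₁ : m₁ ∈ Ioo (0 : ℝ) 1) :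
    SurjOn W (Ioo m₁ 1) (Ioo (W m₁) 1) := by
  intro w hw
  obtain ⟨b, hwb, hb⟩ :=
    ((tendsto_W_one.eventually_const_lt hw.2).and (Ioo_mem_nhdsLT hm₁.2)).exists
  have hcont : ContinuousOn W (Icc m₁ b) :=
    W_continuousOn.mono fun x hx => ⟨hm₁.1.trans_le hx.1, hx.2.trans_lt hb.2⟩
  obtain ⟨x, hx, rfl⟩ := intermediate_value_Ioo hb.1.le hcont ⟨hw.1, hwb⟩
  exact ⟨x, ⟨hx.1, hx.2.trans hb.2⟩, rfl⟩

theorem whitham_velocity_map_bijective (η₁ η₂ : ℝ) (hη₁ : 0 < η₁) (hη : η₁ < η₂) :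
    ContinuousOn (fun α => η₂ ^ 2 * W (α / η₂)) (Ioo η₁ η₂) ∧
    StrictMonoOn (fun α => η₂ ^ 2 * W (α / η₂)) (Ioo η₁ η₂) ∧
    Set.BijOn (fun α => η₂ ^ 2 * W (α / η₂)) (Ioo η₁ η₂)
      (Ioo (η₂ ^ 2 * W (η₁ / η₂)) (η₂ ^ 2)) ∧
    ∀ ξ ∈ Ioo (η₂ ^ 2 * W (η₁ / η₂)) (η₂ ^ 2),
      ∃! α, α ∈ Ioo η₁ η₂ ∧ ξ = η₂ ^ 2 * W (α / η₂) := by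
  have hη₂ : 0 < η₂ := hη₁.trans hη
  have hsq : 0 < η₂ ^ 2 := by positivity
  have hmem₁ : η₁ / η₂ ∈ Ioo (0 : ℝ) 1 := ⟨by positivity, (div_lt_one hη₂).2 hη⟩
  have hmaps : ∀ α ∈ Ioo η₁ η₂, α / η₂ ∈ Ioo (0 : ℝ) 1 := fun α hα =>
    ⟨div_pos (hη₁.trans hα.1) hη₂, (div_lt_one hη₂).2 hα.2⟩
  have hcont : ContinuousOn (fun α => η₂ ^ 2 * W (α / η₂)) (Ioo η₁ η₂) :=
    continuousOn_const.mul (W_continuousOn.comp (by fun_prop) hmaps)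
  have hmono : StrictMonoOn (fun α => η₂ ^ 2 * W (α / η₂)) (Ioo η₁ η₂) := fun a ha b hb hab =>
    mul_lt_mul_of_pos_left (W_strictMonoOn (hmaps a ha) (hmaps b hb)
      (div_lt_div_of_pos_right hab hη₂)) hsq
  have hbij : Set.BijOn (fun α => η₂ ^ 2 * W (α / η₂)) (Ioo η₁ η₂)
      (Ioo (η₂ ^ 2 * W (η₁ / η₂)) (η₂ ^ 2)) := by
    refine ⟨fun α hα => ⟨?_, ?_⟩, hmono.injOn, fun ξ hξ => ?_⟩
    · exact mul_lt_mul_of_pos_left (W_strictMonoOn hmem₁ (hmaps α hα)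
        (div_lt_div_of_pos_right hα.1 hη₂)) hsq
    · exact mul_lt_of_lt_one_right hsq (W_lt_one (hmaps α hα))
    · obtain ⟨x, hx, hxw⟩ := W_surjOn hmem₁ (a := ξ / η₂ ^ 2)
        ⟨(lt_div_iff₀' hsq).2 hξ.1, (div_lt_one hsq).2 hξ.2⟩
      refine ⟨η₂ * x, ⟨(div_lt_iff₀' hη₂).1 hx.1, mul_lt_of_lt_one_right hη₂ hx.2⟩, ?_⟩
      dsimp only
      rw [mul_div_cancel_left₀ _ hη₂.ne', hxw, mul_div_cancel₀ _ hsq.ne']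
  refine ⟨hcont, hmono, hbij, fun ξ hξ => ?_⟩
  obtain ⟨α, hα, hαξ⟩ := hbij.surjOn hξ
  exact ⟨α, ⟨hα, hαξ.symm⟩, fun β hβ => hbij.injOn hβ.1 hα (hβ.2.symm.trans hαξ.symm)⟩
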